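/- Fix x₀ ∈ ℝ and λ ∈ (0,1), and let M = Π_k(x₀) + √λ · Π_r(x₀) (a Hermitian matrix). Define the postselected family σ(y) = M ρ(y) M / Tr[M ρ(y) M] for y near x₀. Then: (i) Tr[M ρ(x₀) M] = λ and σ(x₀) = ρ(x₀); and (ii) σ'(x₀) = (1/√λ) ρ'(x₀) holds if and only if ρ is quasi-pure at x₀. -/

import Mathlib

open Matrix
open scoped Classical

/-- The rank-one matrix `|v⟩⟨w|`, sending `u` to `⟨w, u⟩ v`. -/
noncomputable def ketbra {n : Type*} (v w : n → ℂ) : Matrix n n ℂ :=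
  Matrix.vecMulVec v (star w)


section ketbra

variable {n : Type*}

theorem conjTranspose_ketbra (v w : n → ℂ) : (ketbra v w)ᴴ = ketbra w v := by
  simp [ketbra, Matrix.conjTranspose_vecMulVec]

theorem conjTranspose_sum_ketbra {ι : Type*} [Fintype ι] (v : ι → n → ℂ) :
    (∑ k, ketbra (v k) (v k))ᴴ = ∑ k, ketbra (v k) (v k) := by
  simp [Matrix.conjTranspose_sum, conjTranspose_ketbra]

variable [Fintype n]

theorem mul_ketbra (A : Matrix n n ℂ) (v w : n → ℂ) :
    A * ketbra v w = ketbra (A *ᵥ v) w := by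
  rw [ketbra, ketbra, Matrix.mul_vecMulVec]

theorem ketbra_mul (A : Matrix n n ℂ) (v w : n → ℂ) :
    ketbra v w * A = ketbra v (Aᴴ *ᵥ w) := by
  rw [ketbra, ketbra, Matrix.vecMulVec_mul, Matrix.star_mulVec, Matrix.conjTranspose_conjTranspose]

theorem ketbra_mulVec (v w u : n → ℂ) : ketbra v w *ᵥ u = (star w ⬝ᵥ u) • v := by
  rw [ketbra, Matrix.vecMulVec_mulVec]
  simp

theorem trace_ketbra (v w : n → ℂ) : (ketbra v w).trace = star w ⬝ᵥ v := by
  rw [ketbra, Matrix.trace_vecMulVec, dotProduct_comm]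

theorem sum_ketbra_mulVec {ι : Type*} [Fintype ι] [DecidableEq ι] {v : ι → n → ℂ}
    (hv : ∀ k l, star (v k) ⬝ᵥ v l = if k = l then 1 else 0) (l : ι) :
    (∑ k, ketbra (v k) (v k)) *ᵥ v l = v l := by
  simp [Matrix.sum_mulVec, ketbra_mulVec, hv]

/-- The compression of `A` to the span of orthonormal vectors vanishes iff all matrix elements
of `A` between these vectors do. -/
theorem sum_ketbra_mul_mul_eq_zero_iff {ι : Type*} [Fintype ι] [DecidableEq ι] {v : ι → n → ℂ}
    (hv : ∀ k l, star (v k) ⬝ᵥ v l = if k = l then 1 else 0) (A : Matrix n n ℂ) :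
    (∑ k, ketbra (v k) (v k)) * A * (∑ k, ketbra (v k) (v k)) = 0 ↔
      ∀ k l, star (v k) ⬝ᵥ (A *ᵥ v l) = 0 := by
  constructor
  · intro h k l
    have hk : star (v k) ᵥ* (∑ k, ketbra (v k) (v k)) = star (v k) := by
      conv_rhs => rw [← sum_ketbra_mulVec hv k, Matrix.star_mulVec, conjTranspose_sum_ketbra]
    have h0 : star (v k) ⬝ᵥ
        (((∑ k, ketbra (v k) (v k)) * A * (∑ k, ketbra (v k) (v k))) *ᵥ v l) = 0 := by
      rw [h, Matrix.zero_mulVec, dotProduct_zero]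
    rwa [← Matrix.mulVec_mulVec, sum_ketbra_mulVec hv, ← Matrix.mulVec_mulVec,
      Matrix.dotProduct_mulVec, hk] at h0
  · intro h
    rw [Matrix.mul_assoc, Matrix.sum_mul]
    refine Finset.sum_eq_zero fun k _ => ?_
    rw [Matrix.mul_sum, Matrix.mul_sum]
    refine Finset.sum_eq_zero fun l _ => ?_
    rw [mul_ketbra, mul_ketbra, ketbra_mulVec, h]
    simp [ketbra]

end ketbra

section deriv

variable {n : Type*} {x : ℝ}

/-- A weighted rank-one family whose vector vanishes at `x` has zero derivative at `x`. -/
theorem hasDerivAt_smul_ketbra_apply_of_eq_zero {p : ℝ → ℝ} {p' : ℝ} (hp : HasDerivAt p p' x)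
    {v : ℝ → n → ℂ} {v' : n → ℂ} (hv : ∀ i, HasDerivAt (fun y => v y i) (v' i) x)
    (h0 : v x = 0) (i j : n) :
    HasDerivAt (fun y => ((p y : ℂ) • ketbra (v y) (v y)) i j) 0 x := by
  have h := hp.ofReal_comp.mul ((hv i).mul (hv j).star)
  simpa [ketbra, Matrix.vecMulVec_apply, Pi.mul_def, h0] using h

variable [Fintype n]

theorem hasDerivAt_mulVec_apply (A : Matrix n n ℂ) {v : ℝ → n → ℂ} {v' : n → ℂ}
    (hv : ∀ i, HasDerivAt (fun y => v y i) (v' i) x) (i : n) :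
    HasDerivAt (fun y => (A *ᵥ v y) i) ((A *ᵥ v') i) x := by
  simp only [Matrix.mulVec, dotProduct]
  exact HasDerivAt.fun_sum fun j _ => (hv j).const_mul _

theorem hasDerivAt_mul_mul_apply (A B : Matrix n n ℂ) {F : ℝ → Matrix n n ℂ} {F' : Matrix n n ℂ}
    (hF : ∀ i j, HasDerivAt (fun y => F y i j) (F' i j) x) (i j : n) :
    HasDerivAt (fun y => (A * F y * B) i j) ((A * F' * B) i j) x := by
  simp only [Matrix.mul_apply]
  exact HasDerivAt.fun_sum fun k _ =>
    (HasDerivAt.fun_sum fun l _ => (hF l k).const_mul _).mul_const _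

theorem hasDerivAt_trace {F : ℝ → Matrix n n ℂ} {F' : Matrix n n ℂ}
    (hF : ∀ i j, HasDerivAt (fun y => F y i j) (F' i j) x) :
    HasDerivAt (fun y => (F y).trace) F'.trace x := by
  simp only [Matrix.trace, Matrix.diag_apply]
  exact HasDerivAt.fun_sum fun i _ => hF i i

/-- If `A` annihilates every vector of a spectral family at `x`, then compressing the derivative
of the family at `x` by `A` gives zero. -/
theorem mul_mul_conjTranspose_eq_zero_of_mulVec_eq_zero {ι : Type*} [Fintype ι]
    {F : ℝ → Matrix n n ℂ} {F' : Matrix n n ℂ}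
    (hF' : ∀ i j, HasDerivAt (fun y => F y i j) (F' i j) x)
    {p : ι → ℝ → ℝ} {p' : ι → ℝ} (hp : ∀ k, HasDerivAt (p k) (p' k) x)
    {v : ι → ℝ → n → ℂ} {v' : ι → n → ℂ} (hv : ∀ k i, HasDerivAt (fun y => v k y i) (v' k i) x)
    (hF : ∀ y, F y = ∑ k, (p k y : ℂ) • ketbra (v k y) (v k y))
    {A : Matrix n n ℂ} (hA : ∀ k, A *ᵥ v k x = 0) :
    A * F' * Aᴴ = 0 := by
  ext i j
  refine (hasDerivAt_mul_mul_apply A Aᴴ hF' i j).unique ?_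
  have h : ∀ y, (A * F y * Aᴴ) i j =
      ∑ k, ((p k y : ℂ) • ketbra (A *ᵥ v k y) (A *ᵥ v k y)) i j := by
    intro y
    rw [hF, Matrix.mul_sum, Matrix.sum_mul, Matrix.sum_apply]
    simp only [Matrix.mul_smul, Matrix.smul_mul, mul_ketbra, ketbra_mul,
      Matrix.conjTranspose_conjTranspose]
  simp only [h]
  simpa using HasDerivAt.fun_sum (u := Finset.univ) fun k _ =>
    hasDerivAt_smul_ketbra_apply_of_eq_zero (hp k) (hasDerivAt_mulVec_apply A (hv k)) (hA k) i j

end deriv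

/-- For a parametrized family of density matrices in spectral form,
fix `x₀` and `λ ∈ (0,1)`, let `M = Π_k(x₀) + √λ Π_r(x₀)` and
`σ(y) = M ρ(y) M / Tr[M ρ(y) M]`. Then: (i) `Tr[M ρ(x₀) M] = λ` and `σ(x₀) = ρ(x₀)`;
(ii) `σ'(x₀) = (1/√λ) ρ'(x₀)` holds if and only if `ρ` is quasi-pure at `x₀`, i.e.
`⟨φₖ(x₀), ρ'(x₀) φₗ(x₀)⟩ = 0` for all `k, l`. -/
theorem postselected_state_and_amplified_derivative_iff_quasiPure
    {d r : ℕ}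
    (ρ : ℝ → Matrix (Fin d) (Fin d) ℂ)
    (q : Fin r → ℝ → ℝ) (φ : Fin r → ℝ → Fin d → ℂ)
    (hortho : ∀ x m n, star (φ m x) ⬝ᵥ φ n x = if m = n then 1 else 0)
    (hqpos : ∀ x n, 0 < q n x)
    (hqsum : ∀ x, ∑ n, q n x = 1)
    (hspec : ∀ x, ρ x = ∑ n, (q n x : ℂ) • ketbra (φ n x) (φ n x))
    (x₀ : ℝ)
    (q' : Fin r → ℝ) (hq' : ∀ n, HasDerivAt (q n) (q' n) x₀)
    (φ' : Fin r → Fin d → ℂ)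
    (hφ' : ∀ n i, HasDerivAt (fun y => φ n y i) (φ' n i) x₀)
    (ρ' : Matrix (Fin d) (Fin d) ℂ)
    (hρ' : ∀ i j, HasDerivAt (fun y => ρ y i j) (ρ' i j) x₀)
    (lam : ℝ) (hlam : lam ∈ Set.Ioo (0 : ℝ) 1)
    (Pr Pk M : Matrix (Fin d) (Fin d) ℂ)
    (hPr : Pr = ∑ n, ketbra (φ n x₀) (φ n x₀))
    (hPk : Pk = 1 - Pr)
    (hM : M = Pk + (Real.sqrt lam : ℂ) • Pr)
    (σ : ℝ → Matrix (Fin d) (Fin d) ℂ)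
    (hσ : ∀ y, σ y = ((M * ρ y * M).trace)⁻¹ • (M * ρ y * M)) :
    ((M * ρ x₀ * M).trace = (lam : ℂ) ∧ σ x₀ = ρ x₀) ∧
    ((∀ i j, HasDerivAt (fun y => σ y i j) (((Real.sqrt lam : ℂ))⁻¹ * ρ' i j) x₀) ↔
      (∀ k l, star (φ k x₀) ⬝ᵥ (ρ' *ᵥ φ l x₀) = 0)) := by
  have hs0 : (Real.sqrt lam : ℂ) ≠ 0 := by
    exact_mod_cast (Real.sqrt_pos.2 hlam.1).ne'
  have hs1 : (Real.sqrt lam : ℂ) ≠ 1 := by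
    have : Real.sqrt lam < 1 := by
      rw [Real.sqrt_lt' one_pos]
      simpa using hlam.2
    exact_mod_cast this.ne
  have hs2 : (Real.sqrt lam : ℂ) * Real.sqrt lam = lam := by
    exact_mod_cast Real.mul_self_sqrt hlam.1.le
  generalize (Real.sqrt lam : ℂ) = s at *
  have hlam0 : (lam : ℂ) ≠ 0 := hs2 ▸ mul_ne_zero hs0 hs0
  have hPφ : ∀ n, Pr *ᵥ φ n x₀ = φ n x₀ := fun n => by
    rw [hPr]
    exact sum_ketbra_mulVec (hortho x₀) n
  have hPH : Prᴴ = Pr := by rw [hPr, conjTranspose_sum_ketbra]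
  have hPρ : Pr * ρ x₀ = ρ x₀ := by
    simp only [hspec, Matrix.mul_sum, Matrix.mul_smul, mul_ketbra, hPφ]
  have hρP : ρ x₀ * Pr = ρ x₀ := by
    simp only [hspec, Matrix.sum_mul, Matrix.smul_mul, ketbra_mul, hPH, hPφ]
  have htr : ∀ y, (ρ y).trace = 1 := by
    intro y
    simp only [hspec, Matrix.trace_sum, Matrix.trace_smul, trace_ketbra, hortho]
    simpa using congrArg (fun t : ℝ => (t : ℂ)) (hqsum y)
  have hPP : Pr * Pr = Pr := by
    conv_lhs => rw [hPr, Matrix.mul_sum, ← hPr]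
    simp only [mul_ketbra, hPφ]
    exact hPr.symm
  have htr' : ρ'.trace = 0 := by
    refine (hasDerivAt_trace hρ').unique ?_
    simpa only [htr] using hasDerivAt_const x₀ (1 : ℂ)
  have hMρ : M * ρ x₀ * M = (lam : ℂ) • ρ x₀ := by
    have h1 : M * ρ x₀ = s • ρ x₀ := by
      rw [hM, hPk, add_mul, sub_mul, one_mul, Matrix.smul_mul, hPρ, sub_self, zero_add]
    have h2 : ρ x₀ * M = s • ρ x₀ := by
      rw [hM, hPk, mul_add, mul_sub, mul_one, Matrix.mul_smul, hρP, sub_self, zero_add]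
    rw [h1, Matrix.smul_mul, h2, smul_smul, hs2]
  have htrM : (M * ρ x₀ * M).trace = (lam : ℂ) := by
    rw [hMρ, Matrix.trace_smul, htr, smul_eq_mul, mul_one]
  have hker : ρ' - Pr * ρ' - ρ' * Pr + Pr * ρ' * Pr = 0 := by
    have h := mul_mul_conjTranspose_eq_zero_of_mulVec_eq_zero hρ' hq' hφ' hspec (A := Pk)
      (fun k => by rw [hPk, Matrix.sub_mulVec, hPφ, Matrix.one_mulVec, sub_self])
    rw [hPk, Matrix.conjTranspose_sub, hPH, Matrix.conjTranspose_one] at h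
    rw [← h]
    noncomm_ring
  have hcross : Pr * ρ' + ρ' * Pr = ρ' + Pr * ρ' * Pr := by
    rw [← sub_eq_zero, ← neg_eq_zero, ← hker]
    abel
  have htrP : (Pr * ρ' * Pr).trace = 0 := by
    have h := congrArg Matrix.trace hcross
    have h1 : (Pr * ρ' * Pr).trace = (Pr * ρ').trace := by
      rw [Matrix.trace_mul_comm, ← Matrix.mul_assoc, hPP]
    rw [Matrix.trace_add, Matrix.trace_add, htr', Matrix.trace_mul_comm ρ', h1] at h
    rw [h1]
    linear_combination h
  have hMρ' : M * ρ' * M = s • ρ' + (s * s - s) • (Pr * ρ' * Pr) := by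
    have h1 : M * ρ' * M =
        ρ' + (s - 1) • (Pr * ρ' + ρ' * Pr) + ((s - 1) * (s - 1)) • (Pr * ρ' * Pr) := by
      have h2 : M = 1 + (s - 1) • Pr := by
        rw [hM, hPk]
        module
      rw [h2]
      simp only [add_mul, mul_add, one_mul, mul_one, Matrix.smul_mul, Matrix.mul_smul, smul_add,
        smul_smul]
      abel
    rw [h1, hcross]
    module
  have htrM' : (M * ρ' * M).trace = 0 := by
    rw [hMρ', Matrix.trace_add, Matrix.trace_smul, Matrix.trace_smul, htr', htrP]
    simp
  have hσ' : ∀ i j, HasDerivAt (fun y => σ y i j) ((lam : ℂ)⁻¹ * (M * ρ' * M) i j) x₀ := by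
    intro i j
    have hMρM := hasDerivAt_mul_mul_apply M M hρ'
    have hinv := (hasDerivAt_trace hMρM).fun_inv (by rwa [htrM])
    have h := hinv.fun_mul (hMρM i j)
    simp only [htrM, htrM', neg_zero, zero_div, zero_mul, zero_add] at h
    simpa only [hσ, Matrix.smul_apply, smul_eq_mul] using h
  refine ⟨⟨htrM, ?_⟩, ?_⟩
  · rw [hσ, htrM, hMρ, smul_smul, inv_mul_cancel₀ hlam0, one_smul]
  rw [← sum_ketbra_mul_mul_eq_zero_iff (hortho x₀), ← hPr]
  have hentry : ∀ i j, (lam : ℂ)⁻¹ * (M * ρ' * M) i j =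
      s⁻¹ * ρ' i j + (1 - s⁻¹) * (Pr * ρ' * Pr) i j := by
    intro i j
    rw [hMρ', ← hs2]
    simp only [Matrix.add_apply, Matrix.smul_apply, smul_eq_mul]
    field_simp
  have hs : 1 - s⁻¹ ≠ 0 := by
    rw [sub_ne_zero]
    exact fun h => hs1 (inv_eq_one.1 h.symm)
  constructor
  · intro h
    ext i j
    have h1 := (hσ' i j).unique (h i j)
    rw [hentry, add_eq_left] at h1
    exact (mul_eq_zero.1 h1).resolve_left hs
  · intro h i j
    have h1 := hσ' i j
    rwa [hentry, h, Matrix.zero_apply, mul_zero, add_zero] at h1
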